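/- arXiv:1602.05637 — 3 statements merged into one kernel-verified Lean document; each statement's English description precedes it below -/
import Mathlib

section
/- Let Γ be a simplicial graph and A_Γ the associated right-angled Artin group. For every nontrivial element g ∈ A_Γ there exists a homogeneous quasimorphism φ : A_Γ → ℝ of defect at most 12 with φ(g) ≥ 1. -/
/-- The commutation relations of the right-angled Artin group associated to a
simplicial graph `Γ`: one commutator `[v,w]` for each edge `{v,w}` of `Γ`. -/
def raagRels {V : Type*} (Γ : SimpleGraph V) : Set (FreeGroup V) :=
  {r | ∃ v w : V, Γ.Adj v w ∧
    r = FreeGroup.of v * FreeGroup.of w * (FreeGroup.of v)⁻¹ * (FreeGroup.of w)⁻¹}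

/-- The right-angled Artin group of a simplicial graph. -/
abbrev RAAG {V : Type*} (Γ : SimpleGraph V) : Type _ := PresentedGroup (raagRels Γ)

open Filter Topology

section Homogenization

variable {G K : Type*} [Group G] [Group K]

/-- Some homogeneous quasimorphism of defect at most `12` takes a value at least `1` at `g`. -/
def QuasimorphismDetects (g : G) : Prop :=
  ∃ φ : G → ℝ,
    (∀ x y : G, |φ (x * y) - φ x - φ y| ≤ 12) ∧
    (∀ (x : G) (m : ℤ), φ (x ^ m) = (m : ℝ) * φ x) ∧
    1 ≤ φ g

theorem QuasimorphismDetects.comap (f : G →* K) {g : G} (h : QuasimorphismDetects (f g)) :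
    QuasimorphismDetects g := by
  obtain ⟨φ, hD, hpow, hg⟩ := h
  exact ⟨φ ∘ f, fun x y => by simpa using hD (f x) (f y),
    fun x m => by simpa using hpow (f x) m, hg⟩

theorem eq_zero_of_forall_nat_mul_abs_le {a B : ℝ} (h : ∀ n : ℕ, n * |a| ≤ B) : a = 0 := by
  by_contra ha
  obtain ⟨n, hn⟩ := exists_nat_gt (B / |a|)
  rw [div_lt_iff₀ (abs_pos.mpr ha)] at hn
  exact absurd (h n) (not_le.mpr hn)

theorem QuasimorphismDetects.conj_ne_inv {g : G} (h : QuasimorphismDetects g) (d : G) :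
    d * g * d⁻¹ ≠ g⁻¹ := by
  obtain ⟨φ, hD, hpow, hg⟩ := h
  intro hd
  have hinv (x : G) : φ x⁻¹ = -φ x := by simpa using hpow x (-1)
  have hn (n : ℕ) : φ (g ^ n) = n * φ g := by simpa using hpow g n
  have key : 2 * φ g = 0 := by
    refine eq_zero_of_forall_nat_mul_abs_le (B := 24) fun n => ?_
    have hc : d * g ^ n * d⁻¹ = (g ^ n)⁻¹ := by rw [← conj_pow, hd, inv_pow]
    have h₁ := hD (d * g ^ n) d⁻¹
    have h₂ := hD d (g ^ n)
    rw [hc, hinv, hinv, hn] at h₁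
    rw [hn] at h₂
    rw [← Nat.abs_cast n, ← abs_mul]
    rw [abs_le] at *
    constructor <;> linarith
  linarith

theorem abs_apply_pow_sub_le {φ : G → ℝ} {D : ℝ} (hD : ∀ x y, |φ (x * y) - φ x - φ y| ≤ D)
    (x : G) (n : ℕ) : |φ (x ^ (n + 1)) - (n + 1) * φ x| ≤ n * D := by
  induction n with
  | zero => simp
  | succ n ih =>
    have h := hD (x ^ (n + 1)) x
    rw [← pow_succ] at h
    push_cast
    rw [abs_le] at *
    constructor <;> linarith

theorem exists_tendsto_apply_pow_div {φ : G → ℝ} {D : ℝ}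
    (hD : ∀ x y, |φ (x * y) - φ x - φ y| ≤ D) (x : G) :
    ∃ l, Tendsto (fun n : ℕ => φ (x ^ n) / n) atTop (𝓝 l) := by
  have hD0 : 0 ≤ D := (abs_nonneg _).trans (hD 1 1)
  have hsub : Subadditive fun n : ℕ => φ (x ^ n) + D := by
    intro m n
    have h := hD (x ^ m) (x ^ n)
    rw [← pow_add] at h
    have := (abs_le.mp h).2
    linarith
  have hbdd : BddBelow (Set.range fun n : ℕ => (φ (x ^ n) + D) / n) := by
    refine ⟨-|φ x| - D, ?_⟩
    rintro _ ⟨n, rfl⟩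
    rcases n with _ | n
    · simpa using (by linarith [abs_nonneg (φ x)] : -|φ x| - D ≤ 0)
    · have h := (abs_le.mp (abs_apply_pow_sub_le hD x n)).1
      have h' := neg_abs_le (φ x)
      have hn : (0 : ℝ) < n + 1 := by positivity
      simp only [Nat.cast_add, Nat.cast_one]
      rw [le_div_iff₀ hn]
      nlinarith
  refine ⟨hsub.lim, ?_⟩
  have h₁ := hsub.tendsto_lim hbdd
  have h₂ : Tendsto (fun n : ℕ => D / (n : ℝ)) atTop (𝓝 0) :=
    tendsto_const_div_atTop_nhds_zero_nat D
  simpa [add_div] using h₁.sub h₂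

/-- Homogenizing a quasimorphism of defect `3` that grows at unit speed along powers of `g`. -/
theorem quasimorphismDetects_of_le_apply_pow {φ : G → ℝ}
    (hD : ∀ x y, |φ (x * y) - φ x - φ y| ≤ 3) {g : G} (hg : ∀ n : ℕ, (n : ℝ) ≤ φ (g ^ n)) :
    QuasimorphismDetects g := by
  choose ψ hψ using exists_tendsto_apply_pow_div hD
  have hclose (x : G) : |ψ x - φ x| ≤ 3 := by
    refine le_of_tendsto ((hψ x).sub_const (φ x)).abs ?_
    filter_upwards [eventually_gt_atTop 0] with n hn
    obtain ⟨n, rfl⟩ := Nat.exists_eq_succ_of_ne_zero hn.ne'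
    have h := abs_apply_pow_sub_le hD x n
    have hn' : (0 : ℝ) < n + 1 := by positivity
    have e : φ (x ^ (n + 1)) / ((n + 1 : ℕ) : ℝ) - φ x
        = (φ (x ^ (n + 1)) - (n + 1) * φ x) / (n + 1) := by
      push_cast
      field_simp
    rw [Nat.succ_eq_add_one, e, abs_div, abs_of_pos hn', div_le_iff₀ hn']
    linarith
  have hdefect (x y : G) : |ψ (x * y) - ψ x - ψ y| ≤ 12 := by
    have h := hD x y
    have h₁ := hclose (x * y)
    have h₂ := hclose x
    have h₃ := hclose y
    rw [abs_le] at *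
    constructor <;> linarith
  have hnat (x : G) (k : ℕ) : ψ (x ^ k) = k * ψ x := by
    rcases Nat.eq_zero_or_pos k with rfl | hk
    · have h := hψ (x ^ 0)
      simp only [pow_zero, one_pow] at h
      simpa using tendsto_nhds_unique h (tendsto_const_div_atTop_nhds_zero_nat _)
    · have h : Tendsto (fun n : ℕ => k * (φ (x ^ (k * n)) / ((k * n : ℕ) : ℝ))) atTop
          (𝓝 (k * ψ x)) :=
        ((hψ x).comp (tendsto_id.const_mul_atTop' hk)).const_mul _
      refine tendsto_nhds_unique (hψ (x ^ k)) (h.congr fun n => ?_)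
      have hk' : (k : ℝ) ≠ 0 := by positivity
      rw [pow_mul, Nat.cast_mul, ← mul_div_assoc, mul_div_mul_left _ _ hk']
  have hone : ψ 1 = 0 := by simpa using hnat 1 0
  have hinv (x : G) : ψ x⁻¹ = -ψ x := by
    have : ψ x⁻¹ + ψ x = 0 := by
      refine eq_zero_of_forall_nat_mul_abs_le (B := 12) fun n => ?_
      have h := hdefect (x⁻¹ ^ n) (x ^ n)
      rw [inv_pow, inv_mul_cancel, ← inv_pow, hnat, hnat, hone] at h
      rw [← Nat.abs_cast n, ← abs_mul]
      rw [abs_le] at *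
      constructor <;> linarith
    linarith
  refine ⟨ψ, hdefect, fun x m => ?_, ?_⟩
  · obtain ⟨n, rfl | rfl⟩ := m.eq_nat_or_neg
    · simpa using hnat x n
    · simp [hinv, hnat]
  · refine ge_of_tendsto (hψ g) ?_
    filter_upwards [eventually_gt_atTop 0] with n hn
    rw [le_div_iff₀ (by positivity)]
    simpa using hg n

end Homogenization

section Packing

variable {α β : Type*}

/-- `Packs P L n`: the list `L` contains `n` pairwise disjoint contiguous sublists satisfying `P`. -/
inductive Packs (P : List α → Prop) : List α → ℕ → Prop
  | nil : Packs P [] 0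
  | skip (a : α) {L : List α} {n : ℕ} : Packs P L n → Packs P (a :: L) n
  | take {W L : List α} {n : ℕ} : P W → Packs P L n → Packs P (W ++ L) (n + 1)

namespace Packs

variable {P : List α → Prop} {Q : List β → Prop} {L L' : List α} {m n : ℕ}

theorem zero : ∀ L : List α, Packs P L 0
  | [] => nil
  | a :: L => (zero L).skip a

theorem append (h : Packs P L m) (h' : Packs P L' n) : Packs P (L ++ L') (m + n) := by
  induction h with
  | nil => simpa
  | skip a _ ih => exact ih.skip a
  | take hW _ ih =>
    rw [List.append_assoc, Nat.add_right_comm]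
    exact ih.take hW

theorem of_append (h : Packs P (L ++ L') n) :
    ∃ a b, Packs P L a ∧ Packs P L' b ∧ n ≤ a + b + 1 := by
  generalize hM : L ++ L' = M at h
  induction h generalizing L with
  | nil =>
    obtain ⟨rfl, rfl⟩ := List.append_eq_nil_iff.mp hM
    exact ⟨0, 0, nil, nil, by omega⟩
  | @skip a M n h ih =>
    rcases L with _ | ⟨x, L⟩
    · exact ⟨0, n, nil, by simpa [← hM] using h.skip a, by omega⟩
    · obtain ⟨rfl, hM'⟩ := List.cons_eq_cons.mp hM
      obtain ⟨p, q, hp, hq, hn⟩ := ih hM'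
      exact ⟨p, q, hp.skip x, hq, hn⟩
  | @take W M n hW h ih =>
    rcases List.append_eq_append_iff.mp hM with ⟨U, rfl, rfl⟩ | ⟨U, rfl, rfl⟩
    · exact ⟨0, n, zero _, by simpa using (zero U).append h, by omega⟩
    · obtain ⟨p, q, hp, hq, hn⟩ := ih rfl
      exact ⟨p + 1, q, hp.take hW, hq, by omega⟩

theorem le_length (hP : ¬ P []) (h : Packs P L n) : n ≤ L.length := by
  induction h with
  | nil => simp
  | skip a _ ih => simp; omega
  | @take W L n hW _ ih =>
    have : W ≠ [] := fun h => hP (h ▸ hW)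
    have := List.length_pos_iff.mpr this
    simp
    omega

theorem map {f : α → β} (hPQ : ∀ W, P W → Q (W.map f)) (h : Packs P L n) :
    Packs Q (L.map f) n := by
  induction h with
  | nil => exact nil
  | skip a _ ih => exact ih.skip (f a)
  | take hW _ ih =>
    rw [List.map_append]
    exact ih.take (hPQ _ hW)

theorem replicate (h : P L) : ∀ n, Packs P (List.replicate n L).flatten n
  | 0 => nil
  | n + 1 => by
    rw [List.replicate_succ, List.flatten_cons]
    exact (replicate h n).take h

theorem exists_infix (h : Packs P L n) (hn : n ≠ 0) : ∃ W, P W ∧ W <:+: L := by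
  induction h with
  | nil => exact absurd rfl hn
  | skip a _ ih =>
    obtain ⟨W, hW, hi⟩ := ih hn
    exact ⟨W, hW, hi.trans (List.suffix_cons _ _).isInfix⟩
  | @take W L _ hW _ _ => exact ⟨W, hW, (List.prefix_append _ _).isInfix⟩

end Packs

/-- The maximal number of pairwise disjoint contiguous sublists satisfying `P`. -/
noncomputable def packingNumber (P : List α → Prop) (L : List α) : ℕ :=
  sSup {n | Packs P L n}

variable {P : List α → Prop}

theorem Packs.le_packingNumber (hP : ¬ P []) {L : List α} {n : ℕ} (h : Packs P L n) :
    n ≤ packingNumber P L :=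
  le_csSup ⟨L.length, fun _ h => h.le_length hP⟩ h

theorem packs_packingNumber (hP : ¬ P []) (L : List α) : Packs P L (packingNumber P L) :=
  Nat.sSup_mem (s := {n | Packs P L n}) ⟨0, Packs.zero L⟩ ⟨L.length, fun _ h => h.le_length hP⟩

theorem packingNumber_add_le (hP : ¬ P []) (L L' : List α) :
    packingNumber P L + packingNumber P L' ≤ packingNumber P (L ++ L') :=
  ((packs_packingNumber hP L).append (packs_packingNumber hP L')).le_packingNumber hP

theorem packingNumber_append_le (hP : ¬ P []) (L L' : List α) :
    packingNumber P (L ++ L') ≤ packingNumber P L + packingNumber P L' + 1 := by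
  obtain ⟨a, b, ha, hb, h⟩ := (packs_packingNumber hP (L ++ L')).of_append
  have := ha.le_packingNumber hP
  have := hb.le_packingNumber hP
  omega

theorem packingNumber_map (e : α ≃ α) (hPe : ∀ W, P (W.map e) ↔ P W) (L : List α) :
    packingNumber P (L.map e) = packingNumber P L := by
  unfold packingNumber
  congr 1
  ext n
  refine ⟨fun h => ?_, Packs.map fun W => (hPe W).mpr⟩
  have := Packs.map (Q := P) (f := e.symm) (fun W hW => by
    rw [← hPe]
    simpa [Function.comp_def] using hW) h
  simpa [Function.comp_def] using this

end Packing

section FreeGroupWords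

open FreeGroup

variable {α : Type*}

theorem FreeGroup.IsReduced.exists_cancellation (B : List (α × Bool)) (hB : IsReduced B) :
    ∀ A : List (α × Bool), IsReduced A →
      ∃ p q r, A = p ++ q ∧ B = invRev q ++ r ∧ IsReduced (p ++ r) := by
  intro A
  induction A using List.reverseRecOn generalizing B with
  | nil => exact fun _ => ⟨[], [], B, rfl, rfl, hB⟩
  | append_singleton A a ih =>
    intro hA
    rcases B with _ | ⟨b, B⟩
    · exact ⟨A ++ [a], [], [], by simp, rfl, by simpa using hA⟩
    · by_cases hab : a.1 = b.1 → a.2 = b.2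
      · refine ⟨A ++ [a], [], b :: B, by simp, rfl, ?_⟩
        have h : IsReduced ([a] ++ b :: B) := isReduced_cons_cons.mpr ⟨hab, hB⟩
        exact hA.append_overlap h (by simp)
      · obtain ⟨p, q, r, rfl, rfl, h⟩ := ih B (hB.infix (List.suffix_cons _ _).isInfix)
          (hA.infix (List.prefix_append _ _).isInfix)
        refine ⟨p, q ++ [a], r, by simp, ?_, h⟩
        obtain ⟨a, s⟩ := a
        obtain ⟨b, t⟩ := b
        cases s <;> cases t <;> simp_all [invRev]

theorem FreeGroup.IsReduced.map_prodMap {e : α → α} (he : Function.Injective e)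
    {L : List (α × Bool)} (h : IsReduced L) : IsReduced (L.map (Prod.map e id)) := by
  unfold IsReduced at *
  rw [List.isChain_map]
  exact h.imp fun a b hab hab' => hab (he hab')

theorem FreeGroup.invRev_map_prodMap (e : α → α) (L : List (α × Bool)) :
    invRev (L.map (Prod.map e id)) = (invRev L).map (Prod.map e id) := by
  simp [invRev, List.map_reverse, Function.comp_def]

variable [DecidableEq α]

theorem FreeGroup.toWord_freeGroupCongr (e : α ≃ α) (u : FreeGroup α) :
    (freeGroupCongr e u).toWord = u.toWord.map (Prod.map e id) := by
  have h : freeGroupCongr e u = mk (u.toWord.map (Prod.map e id)) := by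
    conv_lhs => rw [← mk_toWord (x := u)]
    rfl
  rw [h, toWord_mk, (isReduced_toWord.map_prodMap e.injective).reduce_eq]

theorem FreeGroup.exists_toWord_mul (u v : FreeGroup α) :
    ∃ p q r, u.toWord = p ++ q ∧ v.toWord = invRev q ++ r ∧ (u * v).toWord = p ++ r := by
  obtain ⟨p, q, r, hu, hv, h⟩ :=
    IsReduced.exists_cancellation v.toWord isReduced_toWord u.toWord isReduced_toWord
  refine ⟨p, q, r, hu, hv, ?_⟩
  have : u * v = mk (p ++ r) := by
    rw [← mk_toWord (x := u), ← mk_toWord (x := v), hu, hv, ← mul_mk, ← mul_mk, ← mul_mk,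
      ← inv_mk]
    group
  rw [this, toWord_mk, h.reduce_eq]

/-- The antisymmetrized count of disjoint subwords satisfying `P` in the reduced form of `u`. -/
noncomputable def signedPackingNumber (P : List (α × Bool) → Prop) (u : FreeGroup α) : ℝ :=
  packingNumber P u.toWord - packingNumber P u⁻¹.toWord

theorem abs_signedPackingNumber_mul_sub_le {P : List (α × Bool) → Prop} (hP : ¬ P [])
    (u v : FreeGroup α) :
    |signedPackingNumber P (u * v) - signedPackingNumber P u - signedPackingNumber P v| ≤ 3 := by
  obtain ⟨p, q, r, hu, hv, huv⟩ := exists_toWord_mul u v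
  unfold signedPackingNumber
  rw [toWord_inv, toWord_inv, toWord_inv, hu, hv, huv]
  simp only [invRev_append, invRev_invRev]
  have l (A B : List (α × Bool)) : (packingNumber P A + packingNumber P B : ℝ) ≤
      packingNumber P (A ++ B) := mod_cast packingNumber_add_le hP A B
  have r (A B : List (α × Bool)) : (packingNumber P (A ++ B) : ℝ) ≤
      packingNumber P A + packingNumber P B + 1 := mod_cast packingNumber_append_le hP A B
  rename_i r'
  rw [abs_le]
  constructor
  · linarith [l p r', r p q, r (invRev q) r', r (invRev r') (invRev p),
      l (invRev q) (invRev p), l (invRev r') q]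
  · linarith [r p r', l p q, l (invRev q) r', l (invRev r') (invRev p),
      r (invRev q) (invRev p), r (invRev r') q]

end FreeGroupWords

section SemidirectProduct

open FreeGroup

variable {H S : Type*} [Group H] [MulAction H S]

/-- The action on a free group that permutes a basis. -/
def freeGroupMulAut (H S : Type*) [Group H] [MulAction H S] : H →* MulAut (FreeGroup S) where
  toFun h := freeGroupCongr (MulAction.toPerm h)
  map_one' := by
    ext u
    change FreeGroup.map (MulAction.toPerm (1 : H)) u = u
    rw [MulAction.toPerm_one]
    exact FreeGroup.map.id u
  map_mul' g h := by
    rw [MulAut.mul_def, freeGroupCongr_trans]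
    congr 1
    ext s
    exact mul_smul g h s

/-- `W` is a translate of `L`. -/
def IsTranslate (H : Type*) {S : Type*} [Group H] [MulAction H S] (L W : List (S × Bool)) : Prop :=
  ∃ h : H, W = L.map (Prod.map (h • ·) id)

theorem isTranslate_map_iff (L W : List (S × Bool)) (h : H) :
    IsTranslate H L (W.map (Prod.map (h • ·) id)) ↔ IsTranslate H L W := by
  constructor
  · rintro ⟨k, hk⟩
    refine ⟨h⁻¹ * k, ?_⟩
    have := congrArg (List.map (Prod.map (h⁻¹ • ·) id)) hk
    simpa [Function.comp_def, Prod.map_def, mul_smul] using this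
  · rintro ⟨k, rfl⟩
    exact ⟨h * k, by simp [Function.comp_def, Prod.map_def, mul_smul]⟩

theorem List.getElem?_flatten_replicate {α : Type*} (L : List α) (n : ℕ) {j : ℕ}
    (hj : j < (List.replicate n L).flatten.length) :
    (List.replicate n L).flatten[j]? = L[j % L.length]? := by
  induction n generalizing j with
  | zero => simp at hj
  | succ n ih =>
    rw [List.replicate_succ, List.flatten_cons] at hj ⊢
    rcases lt_or_ge j L.length with h | h
    · rw [List.getElem?_append_left h, Nat.mod_eq_of_lt h]
    · rw [List.getElem?_append_right h, ih (by rw [List.length_append] at hj; omega),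
        ← Nat.mod_eq_sub_mod h]

/-- If no element of `H` swaps two points, then a power of a reduced word does not contain the
inverse of a translate of that word. -/
theorem not_isTranslate_of_infix_invRev_flatten
    (hS : ∀ (h : H) (s t : S), h • s = t → h • t = s → s = t) {L : List (S × Bool)}
    (hL : IsReduced L) (hne : L ≠ []) (n : ℕ) {W : List (S × Bool)}
    (hW : W <:+: invRev (List.replicate n L).flatten) : ¬ IsTranslate H L W := by
  rintro ⟨h, rfl⟩
  obtain ⟨B, A, hAB⟩ := hW
  have hpos : 0 < L.length := List.length_pos_iff.mpr hne
  have hM : (List.replicate n L).flatten =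
      invRev A ++ ((invRev L).map (Prod.map (h • ·) id) ++ invRev B) := by
    rw [← invRev_map_prodMap, ← invRev_append, ← invRev_append, hAB, invRev_invRev]
  obtain ⟨a, ha, hmod⟩ : ∃ a < L.length, ∀ i, (A.length + i) % L.length = (a + i) % L.length :=
    ⟨A.length % L.length, Nat.mod_lt _ hpos, fun i => by simp⟩
  have key (i : ℕ) (hi : i < L.length) : L[(a + i) % L.length]? =
      L[L.length - 1 - i]?.map fun x => (h • x.1, !x.2) := by
    have hlen : A.length + i < (List.replicate n L).flatten.length := by
      rw [hM]
      simp only [List.length_append, List.length_map, invRev_length]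
      omega
    rw [← hmod, ← List.getElem?_flatten_replicate L n hlen, hM,
      List.getElem?_append_right (by simp), List.getElem?_append_left (by simpa using hi)]
    simp [invRev, hi, Function.comp_def]
  have reflect (j k : ℕ) (hj : j < L.length) (hk : k < L.length)
      (hjk : j + k = a + (L.length - 1)) : L[k] = (h • L[j].1, !L[j].2) := by
    have := key (L.length - 1 - j) (by omega)
    rw [show a + (L.length - 1 - j) = k by omega, Nat.mod_eq_of_lt hk,
      show L.length - 1 - (L.length - 1 - j) = j by omega] at this
    simpa [hj, hk] using this
  obtain ⟨j, hj | hj⟩ := Nat.even_or_odd' (a + (L.length - 1))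
  · have := congrArg Prod.snd (reflect j j (by omega) (by omega) (by omega))
    simp at this
  · have h₁ := reflect j (j + 1) (by omega) (by omega) (by omega)
    have h₂ := reflect (j + 1) j (by omega) (by omega) (by omega)
    have hred := List.isChain_iff_getElem.mp hL j (by omega)
    have := hred (hS h _ _ (congrArg Prod.fst h₁).symm (congrArg Prod.fst h₂).symm)
    rw [congrArg Prod.snd h₁] at this
    simp at this

theorem quasimorphismDetects_inl
    (hS : ∀ (h : H) (s t : S), h • s = t → h • t = s → s = t) {w : FreeGroup S} (hw : w ≠ 1) :
    QuasimorphismDetects (SemidirectProduct.inl w : FreeGroup S ⋊[freeGroupMulAut H S] H) := by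
  classical
  obtain ⟨c, L, hL, hne, rfl⟩ : ∃ (c : FreeGroup S) (L : List (S × Bool)),
      IsCyclicallyReduced L ∧ L ≠ [] ∧ w = c * mk L * c⁻¹ := by
    refine ⟨mk (reduceCyclically.conjugator w.toWord), reduceCyclically w.toWord,
      reduceCyclically.isCyclicallyReduced isReduced_toWord, fun h => hw ?_, ?_⟩
    all_goals
      have := reduceCyclically.conj_conjugator_reduceCyclically w.toWord
    · rw [h, List.append_nil] at this
      rw [← mk_toWord (x := w), ← this, ← mul_mk, ← inv_mk, mul_inv_cancel]
    · conv_lhs => rw [← mk_toWord (x := w), ← this, ← mul_mk, ← mul_mk, ← inv_mk]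
  have hP : ¬ IsTranslate H L [] := by
    rintro ⟨h, hh⟩
    exact hne (List.map_eq_nil_iff.mp hh.symm)
  set P := IsTranslate H L
  have hinv (h : H) (u : FreeGroup S) :
      signedPackingNumber P (freeGroupMulAut H S h u) = signedPackingNumber P u := by
    have hmap (L' : List (S × Bool)) := packingNumber_map (P := P)
      (Equiv.prodCongr (MulAction.toPerm h) (Equiv.refl Bool))
      (fun W => isTranslate_map_iff L W h) L'
    unfold signedPackingNumber
    rw [← _root_.map_inv (freeGroupMulAut H S h) u]
    change (packingNumber P (freeGroupCongr (MulAction.toPerm h) u).toWord : ℝ) -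
      packingNumber P (freeGroupCongr (MulAction.toPerm h) u⁻¹).toWord = _
    rw [toWord_freeGroupCongr, toWord_freeGroupCongr]
    exact congrArg₂ (fun a b : ℕ => (a : ℝ) - b) (hmap _) (hmap _)
  have hconj : (MulAut.conj (SemidirectProduct.inl c)⁻¹ : MulAut (FreeGroup S
      ⋊[freeGroupMulAut H S] H)).toMonoidHom (SemidirectProduct.inl (c * mk L * c⁻¹)) =
      SemidirectProduct.inl (mk L) := by
    simp [mul_assoc]
  refine QuasimorphismDetects.comap (MulAut.conj (SemidirectProduct.inl c)⁻¹).toMonoidHom ?_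
  rw [hconj]
  refine quasimorphismDetects_of_le_apply_pow (φ := fun x => signedPackingNumber P x.left)
    (fun x y => ?_) fun n => ?_
  · have := abs_signedPackingNumber_mul_sub_le hP x.left (freeGroupMulAut H S x.right y.left)
    rwa [hinv] at this
  · have hword : (mk L ^ n).toWord = (List.replicate n L).flatten := by
      rw [pow_mk, toWord_mk, (hL.flatten_replicate n).isReduced.reduce_eq]
    have h₀ : packingNumber P (invRev (List.replicate n L).flatten) = 0 := by
      by_contra hn
      obtain ⟨W, hW, hi⟩ := (packs_packingNumber hP _).exists_infix hn
      exact not_isTranslate_of_infix_invRev_flatten hS hL.isReduced hne n hi hW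
    have h₁ : n ≤ packingNumber P (List.replicate n L).flatten :=
      (Packs.replicate ⟨1, by simp [Prod.map_def]⟩ n).le_packingNumber hP
    rw [← _root_.map_pow, SemidirectProduct.left_inl]
    unfold signedPackingNumber
    rw [toWord_inv, hword, h₀]
    simpa using h₁

end SemidirectProduct

section RightAngledArtinGroup

theorem eq_of_swap_quotient {H : Type*} [Group H]
    (hdet : ∀ h : H, h ≠ 1 → QuasimorphismDetects h) (C : Subgroup H) (ρ : H →* C)
    (hρ : ∀ c : C, ρ c = c) (h : H) (s t : H ⧸ C) (hst : h • s = t) (hts : h • t = s) : s = t := by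
  induction s using QuotientGroup.induction_on with | H a
  induction t using QuotientGroup.induction_on with | H b
  rw [MulAction.Quotient.smul_coe, smul_eq_mul, QuotientGroup.eq] at hst hts
  rw [QuotientGroup.eq]
  set k := a⁻¹ * b with hk
  set c := (h * a)⁻¹ * b with hc
  set d := (h * b)⁻¹ * a with hd
  have hρ' (x : H) (hx : x ∈ C) : (ρ x : H) = x := congrArg Subtype.val (hρ ⟨x, hx⟩)
  have hkd : k * d * k = c := by
    rw [hk, hd, hc]
    group
  have hρkd : (ρ k : H) * d * ρ k = c := by
    have := congrArg (fun x => (ρ x : H)) hkd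
    simpa only [map_mul, Subgroup.coe_mul, hρ' d hts, hρ' c hst] using this
  have hm : k * (ρ k : H)⁻¹ = 1 := by
    by_contra hm
    refine (hdet _ hm).conj_ne_inv (ρ k * d) (mul_left_cancel (a := k * (ρ k : H)⁻¹) ?_)
    calc k * (ρ k : H)⁻¹ * (ρ k * d * (k * (ρ k : H)⁻¹) * (ρ k * d)⁻¹)
        = k * d * k * (ρ k * d * ρ k)⁻¹ := by group
      _ = k * (ρ k : H)⁻¹ * (k * (ρ k : H)⁻¹)⁻¹ := by
        rw [hkd, hρkd, mul_inv_cancel, mul_inv_cancel]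
  rw [mul_inv_eq_one.mp hm]
  exact SetLike.coe_mem _

variable {V : Type*} {Γ : SimpleGraph V}

theorem RAAG.commute_of {v w : V} (h : Γ.Adj v w) :
    Commute (PresentedGroup.of v : RAAG Γ) (PresentedGroup.of w) := by
  have : PresentedGroup.mk (raagRels Γ) (FreeGroup.of v * FreeGroup.of w * (FreeGroup.of v)⁻¹ *
      (FreeGroup.of w)⁻¹) = 1 := PresentedGroup.one_of_mem ⟨v, w, h, rfl⟩
  simp only [map_mul, map_inv] at this
  rwa [mul_inv_eq_one, mul_inv_eq_iff_eq_mul] at this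

theorem RAAG.exists_lift {K : Type*} [Group K] (f : V → K)
    (hf : ∀ v w, Γ.Adj v w → Commute (f v) (f w)) :
    ∃ F : RAAG Γ →* K, ∀ v, F (PresentedGroup.of v) = f v := by
  refine ⟨PresentedGroup.toGroup (f := f) ?_, fun v => PresentedGroup.toGroup.of _⟩
  rintro _ ⟨v, w, h, rfl⟩
  simp [(hf v w h).eq]

/-- The subgroup generated by the vertices in `T`. -/
def RAAG.special (Γ : SimpleGraph V) (T : Set V) : Subgroup (RAAG Γ) :=
  Subgroup.closure (PresentedGroup.of '' T)

theorem RAAG.of_mem_special {T : Set V} {v : V} (hv : v ∈ T) :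
    (PresentedGroup.of v : RAAG Γ) ∈ special Γ T :=
  Subgroup.subset_closure ⟨v, hv, rfl⟩

theorem RAAG.special_mono {T T' : Set V} (h : T ⊆ T') : special Γ T ≤ special Γ T' :=
  Subgroup.closure_mono (Set.image_mono h)

theorem RAAG.exists_retraction (Γ : SimpleGraph V) (T : Set V) :
    ∃ ρ : RAAG Γ →* special Γ T, ∀ x : special Γ T, ρ x = x := by
  classical
  obtain ⟨ρ, hρ⟩ := exists_lift (Γ := Γ)
    (fun v => if hv : v ∈ T then (⟨PresentedGroup.of v, of_mem_special hv⟩ : special Γ T) else 1)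
    (by
      intro v w h
      by_cases hv : v ∈ T <;> by_cases hw : w ∈ T <;> simp [hv, hw]
      exact Subtype.ext (commute_of h))
  refine ⟨ρ, fun ⟨x, hx⟩ => ?_⟩
  have : Set.EqOn ((special Γ T).subtype.comp ρ) (MonoidHom.id _) (special Γ T) := by
    refine MonoidHom.eqOn_closure ?_
    rintro _ ⟨v, hv, rfl⟩
    simp [hρ, hv]
  exact Subtype.ext (this hx)

theorem RAAG.exists_mem_special (g : RAAG Γ) : ∃ T : Finset V, g ∈ special Γ (T : Set V) := by
  classical
  have hg : g ∈ Subgroup.closure (Set.range (PresentedGroup.of (rels := raagRels Γ))) := by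
    rw [PresentedGroup.closure_range_of]
    trivial
  induction hg using Subgroup.closure_induction with
  | mem x hx =>
    obtain ⟨v, rfl⟩ := hx
    exact ⟨{v}, of_mem_special (by simp)⟩
  | one => exact ⟨∅, one_mem _⟩
  | mul x y _ _ hx hy =>
    obtain ⟨T, hT⟩ := hx
    obtain ⟨T', hT'⟩ := hy
    refine ⟨T ∪ T', mul_mem (special_mono ?_ hT) (special_mono ?_ hT')⟩ <;> simp
  | inv x _ hx =>
    obtain ⟨T, hT⟩ := hx
    exact ⟨T, inv_mem hT⟩

/-- The subgroup generated by `T` and `v` splits as a semidirect product of the subgroup `H`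
generated by `T` with a free group on the cosets in `H` of the subgroup generated by those
elements of `T` that are adjacent to `v`. -/
theorem RAAG.exists_hom_semidirectProduct {T : Set V} {v : V} (hv : v ∉ T) :
    let C := (special Γ {w | w ∈ T ∧ Γ.Adj v w}).subgroupOf (special Γ T)
    ∃ f : RAAG Γ →*
        FreeGroup (special Γ T ⧸ C) ⋊[freeGroupMulAut (special Γ T) (special Γ T ⧸ C)] special Γ T,
      ∀ g ∈ special Γ (insert v T), f g = 1 → g = 1 := by
  classical
  intro C
  obtain ⟨f, hf⟩ := exists_lift (Γ := Γ) (fun w =>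
    if w = v then (SemidirectProduct.inl (FreeGroup.of ((1 : special Γ T) : special Γ T ⧸ C)) :
      FreeGroup (special Γ T ⧸ C) ⋊[freeGroupMulAut (special Γ T) (special Γ T ⧸ C)] special Γ T)
    else if hw : w ∈ T then SemidirectProduct.inr ⟨PresentedGroup.of w, of_mem_special hw⟩ else 1)
    (by
      have hcomm (w : V) (hw : w ∈ T) (hvw : Γ.Adj v w) : Commute
          (SemidirectProduct.inl (FreeGroup.of ((1 : special Γ T) : special Γ T ⧸ C)) :
            FreeGroup (special Γ T ⧸ C) ⋊[freeGroupMulAut _ (special Γ T ⧸ C)] special Γ T)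
          (SemidirectProduct.inr ⟨PresentedGroup.of w, of_mem_special hw⟩) := by
        set h : special Γ T := ⟨PresentedGroup.of w, of_mem_special hw⟩
        have hfix : h • ((1 : special Γ T) : special Γ T ⧸ C) = (1 : special Γ T) := by
          rw [MulAction.Quotient.smul_coe, smul_eq_mul, mul_one]
          refine (QuotientGroup.eq.mpr ?_).symm
          rw [inv_one, one_mul]
          exact Subgroup.mem_subgroupOf.mpr (of_mem_special ⟨hw, hvw⟩)
        have haut : freeGroupMulAut _ (special Γ T ⧸ C) h (FreeGroup.of (1 : special Γ T)) =
            FreeGroup.of ((1 : special Γ T) : special Γ T ⧸ C) :=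
          congrArg FreeGroup.of hfix
        have := SemidirectProduct.inl_aut (φ := freeGroupMulAut _ (special Γ T ⧸ C)) h
          (FreeGroup.of (1 : special Γ T))
        rw [haut, map_inv, eq_mul_inv_iff_mul_eq] at this
        exact this
      intro w₁ w₂ hw
      by_cases h₁ : w₁ = v <;> by_cases h₂ : w₂ = v
      · simp [h₁, h₂]
      · subst h₁
        by_cases hT : w₂ ∈ T
        · simpa [h₂, hT] using hcomm w₂ hT hw
        · simp [h₂, hT]
      · subst h₂
        by_cases hT : w₁ ∈ T
        · simpa [h₁, hT] using (hcomm w₁ hT hw.symm).symm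
        · simp [h₁, hT]
      · by_cases hT₁ : w₁ ∈ T <;> by_cases hT₂ : w₂ ∈ T <;> simp [h₁, h₂, hT₁, hT₂]
        exact Commute.map (show Commute _ _ from Subtype.ext (commute_of hw).eq) SemidirectProduct.inr)
  let t : special Γ T ⧸ C → RAAG Γ := Quotient.lift
    (fun h : special Γ T => (h : RAAG Γ) * PresentedGroup.of v * (h : RAAG Γ)⁻¹) (by
      intro a b hab
      have hc : a⁻¹ * b ∈ C := QuotientGroup.leftRel_apply.mp hab
      have hcomm : special Γ {w | w ∈ T ∧ Γ.Adj v w} ≤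
          Subgroup.centralizer {(PresentedGroup.of v : RAAG Γ)} := by
        refine (Subgroup.closure_le _).mpr ?_
        rintro _ ⟨w, hw, rfl⟩
        exact Subgroup.mem_centralizer_singleton_iff.mpr (commute_of hw.2).symm.eq
      have h := Subgroup.mem_centralizer_singleton_iff.mp (hcomm (Subgroup.mem_subgroupOf.mp hc))
      have hb : (b : RAAG Γ) = a * ((a⁻¹ * b : special Γ T) : RAAG Γ) := by simp
      change (a : RAAG Γ) * _ * (a : RAAG Γ)⁻¹ = b * _ * (b : RAAG Γ)⁻¹
      rw [hb, mul_assoc (a : RAAG Γ) _ (PresentedGroup.of v), h]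
      group)
  let F : FreeGroup (special Γ T ⧸ C) ⋊[freeGroupMulAut (special Γ T) (special Γ T ⧸ C)]
      special Γ T →* RAAG Γ :=
    SemidirectProduct.lift (FreeGroup.lift t) (special Γ T).subtype (by
      intro h
      ext s
      induction s using QuotientGroup.induction_on with | H a
      have e : freeGroupMulAut (special Γ T) (special Γ T ⧸ C) h (FreeGroup.of (a : _ ⧸ C)) =
        FreeGroup.of ((h * a : special Γ T) : special Γ T ⧸ C) := rfl
      have ht (b : special Γ T) : t (b : special Γ T ⧸ C) =
        (b : RAAG Γ) * PresentedGroup.of v * (b : RAAG Γ)⁻¹ := rfl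
      simp [e, ht, mul_assoc])
  refine ⟨f, fun g hg hfg => ?_⟩
  have hid : Set.EqOn (F.comp f) (MonoidHom.id _) (special Γ (insert v T)) := by
    refine MonoidHom.eqOn_closure ?_
    rintro _ ⟨w, rfl | hw, rfl⟩
    · have ht : t ((1 : special Γ T) : special Γ T ⧸ C) = 1 * PresentedGroup.of w * 1⁻¹ := rfl
      simp [hf, F, ht]
    · have hwv : w ≠ v := fun h => hv (h ▸ hw)
      simp [hf, F, hw, hwv]
  have := hid hg
  rw [MonoidHom.comp_apply, hfg, map_one] at this
  exact this.symm

theorem RAAG.quasimorphismDetects_of_mem_special (T : Finset V) :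
    ∀ g ∈ special Γ (T : Set V), g ≠ 1 → QuasimorphismDetects g := by
  classical
  induction T using Finset.induction_on with
  | empty =>
    intro g hg hne
    simp [special] at hg
    exact absurd hg hne
  | insert v T hv ih =>
    intro g hg hne
    rw [Finset.coe_insert] at hg
    obtain ⟨f, hf⟩ := exists_hom_semidirectProduct (Γ := Γ) (T := (T : Set V)) (v := v) (by simpa)
    have hfg : f g ≠ 1 := fun h => hne (hf g hg h)
    refine QuasimorphismDetects.comap f ?_
    by_cases hr : (f g).right = 1
    · have hl : f g = SemidirectProduct.inl (f g).left := by
        ext <;> simp [hr]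
      rw [hl]
      obtain ⟨ρ, hρ⟩ := exists_retraction Γ {w | w ∈ (T : Set V) ∧ Γ.Adj v w}
      have hle : special Γ {w | w ∈ (T : Set V) ∧ Γ.Adj v w} ≤ special Γ (T : Set V) :=
        special_mono fun _ hw => hw.1
      let e := Subgroup.subgroupOfEquivOfLe hle
      refine quasimorphismDetects_inl (eq_of_swap_quotient (fun h hh => ?_) _
        ((e.symm.toMonoidHom.comp ρ).comp (special Γ (T : Set V)).subtype) fun c => ?_) ?_
      · exact QuasimorphismDetects.comap (special Γ (T : Set V)).subtype
          (ih _ h.2 (by simpa using hh))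
      · exact (e.symm_apply_eq).mpr (hρ (e c))
      · intro h
        rw [h, map_one] at hl
        exact hfg hl
    · refine QuasimorphismDetects.comap
        ((special Γ (T : Set V)).subtype.comp SemidirectProduct.rightHom) ?_
      refine ih _ (SetLike.coe_mem _) ?_
      simpa using hr

end RightAngledArtinGroup

/-- For every nontrivial element `g` of a right-angled Artin group there is a
homogeneous quasimorphism `φ` of defect at most `12` with `φ g ≥ 1`. -/
theorem raag_exists_effective_quasimorphism {V : Type*} (Γ : SimpleGraph V)
    (g : RAAG Γ) (hg : g ≠ 1) :
    ∃ φ : RAAG Γ → ℝ,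
      (∀ x y : RAAG Γ, |φ (x * y) - φ x - φ y| ≤ 12) ∧
      (∀ (x : RAAG Γ) (m : ℤ), φ (x ^ m) = (m : ℝ) * φ x) ∧
      1 ≤ φ g := by
  obtain ⟨T, hT⟩ := RAAG.exists_mem_special g
  exact RAAG.quasimorphismDetects_of_mem_special T g hT hg
end

section
/- Let P be a partially ordered set of width d < ∞ equipped with a free action of an infinite cyclic group ⟨g⟩ by order automorphisms, and let A ⊆ P be an antichain of cardinality d that is both g-descending and spans P. Then P = ⋃_{k ∈ ℤ} g^k [A, gA]; that is, every element p ∈ P lies in g^k [A, gA] for some integer k. -/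
/-- The set `[A, gA] = {p ∈ P : x ≥ p ≥ y for some x, y ∈ A ∪ gA}`, for an
order automorphism `g` of a poset `P` and a finite set `A ⊆ P`. -/
def gInterval {P : Type*} [PartialOrder P] (g : P ≃o P) (A : Finset P) : Set P :=
  {p | ∃ x ∈ (↑A : Set P) ∪ (⇑g '' (↑A : Set P)),
       ∃ y ∈ (↑A : Set P) ∪ (⇑g '' (↑A : Set P)), y ≤ p ∧ p ≤ x}

/-- In a poset whose finite antichains have at most `A.card` elements, every element is comparable
to an element of the antichain `A`. -/
theorem exists_comparable_of_card_le {P : Type*} [PartialOrder P] {A : Finset P}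
    (hA : IsAntichain (· ≤ ·) (↑A : Set P))
    (hmax : ∀ s : Finset P, IsAntichain (· ≤ ·) (↑s : Set P) → s.card ≤ A.card) (p : P) :
    ∃ a ∈ A, p ≤ a ∨ a ≤ p := by
  classical
  by_contra! h
  have hp : p ∉ A := fun hp => (h p hp).1 le_rfl
  have hins : IsAntichain (· ≤ ·) (↑(insert p A) : Set P) := by
    rw [Finset.coe_insert]
    exact hA.insert (fun a ha _ => (h a ha).2) (fun a ha _ => (h a ha).1)
  have hcard := hmax _ hins
  rw [Finset.card_insert_of_notMem hp] at hcard
  omega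

/-- The powers of an order automorphism satisfy `g ^ k x ≤ y ↔ x ≤ g ^ (-k) y`. -/
theorem OrderIso.zpow_apply_le_iff {P : Type*} [PartialOrder P] (g : P ≃o P) (k : ℤ) (x y : P) :
    (g ^ k) x ≤ y ↔ x ≤ (g ^ (-k)) y := by
  rw [← (g ^ (-k)).le_iff_le, ← RelIso.mul_apply, ← zpow_add, neg_add_cancel, zpow_zero,
    RelIso.one_apply]

/-- If `P` is a poset of width `d < ∞` with a free action of the infinite
cyclic group generated by an order automorphism `g`, and `A` is an antichain
of cardinality `d` that is `g`-descending and spans `P`, then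
`P = ⋃_{k ∈ ℤ} g^k [A, gA]`. -/
theorem union_translates_interval {P : Type*} [PartialOrder P] (d : ℕ) (g : P ≃o P)
    (hfree : ∀ (p : P) (n : ℤ), n ≠ 0 → (g ^ n) p ≠ p)
    (hub : ∀ s : Finset P, IsAntichain (· ≤ ·) (↑s : Set P) → s.card ≤ d)
    (A : Finset P) (hA : IsAntichain (· ≤ ·) (↑A : Set P)) (hAcard : A.card = d)
    (hdesc : ∀ a ∈ A, ∀ a' ∈ A, ¬ a' < g a)
    (hspan : ∀ p : P, ∃ a ∈ A, ∃ a' ∈ A, ∃ r s : ℤ, p < (g ^ r) a ∧ (g ^ s) a' < p) :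
    ∀ p : P, ∃ k : ℤ, ∃ q ∈ gInterval g A, (g ^ k) q = p := by
  intro p
  subst hAcard
  have hcomp := exists_comparable_of_card_le hA hub
  have habove : ∀ a ∈ A, ∃ b ∈ A, g a ≤ b := by
    intro a ha
    obtain ⟨b, hb, h | h⟩ := hcomp (g a)
    · exact ⟨b, hb, h⟩
    · exact ⟨b, hb, (h.eq_of_not_lt (hdesc a ha b hb)).ge⟩
  let q : ℤ → P := fun k => (g ^ (-k)) p
  have hq : ∀ k, g (q (k + 1)) = q k := by
    intro k
    change (g * g ^ (-(k + 1))) p = _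
    rw [← zpow_one_add]
    congr 2
    ring
  have hanti : ∀ k, (∃ a ∈ A, q (k + 1) ≤ a) → ∃ a ∈ A, q k ≤ a := by
    rintro k ⟨a, ha, h⟩
    obtain ⟨b, hb, hab⟩ := habove a ha
    exact ⟨b, hb, hq k ▸ (g.monotone h).trans hab⟩
  obtain ⟨a, ha, b, hb, r, s, hpa, hbp⟩ := hspan p
  have hr : ∃ a ∈ A, q r ≤ a := by
    refine ⟨a, ha, (g.zpow_apply_le_iff _ _ _).2 ?_⟩
    simpa using hpa.le
  have hs : b ≤ q s := (g.zpow_apply_le_iff _ _ _).1 hbp.le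
  have key : ∃ k, (∃ a ∈ A, q k ≤ a) ∧ ∃ b ∈ A, b ≤ q (k + 1) := by
    by_contra! hno
    have hall : ∀ k, ∃ a ∈ A, q k ≤ a := by
      intro k
      induction k using Int.inductionOn' (b := r) with
      | zero => exact hr
      | succ k _ ih =>
        obtain ⟨a, ha, h | h⟩ := hcomp (q (k + 1))
        · exact ⟨a, ha, h⟩
        · exact absurd h (hno k ih a ha)
      | pred k _ ih => exact hanti (k - 1) (by simpa using ih)
    exact hno (s - 1) (hall _) b hb (by simpa using hs)
  obtain ⟨k, ⟨x, hx, hqx⟩, y, hy, hyq⟩ := key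
  refine ⟨k, q k, ⟨x, Or.inl hx, g y, Or.inr ⟨y, hy, rfl⟩, hq k ▸ g.monotone hyq, hqx⟩, ?_⟩
  change (g ^ k * g ^ (-k)) p = p
  rw [← zpow_add, add_neg_cancel, zpow_zero, RelIso.one_apply]
end

section
/- Let P be a partially ordered set and let A, B ⊆ P be antichains, each of finite cardinality d, such that every p ∈ P satisfies x ≥ p ≥ y for some x ∈ A and y ∈ B. Suppose P is partitioned into d chains Q₁, …, Q_d. Then each chain Q_i contains exactly one element of A and exactly one element of B, and these elements are respectively the maximum and the minimum of the chain Q_i. -/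
/-- An antichain with as many elements as there are chains in a partition of the poset meets each
of these chains in exactly one element. -/
theorem IsAntichain.existsUnique_mem_inter_of_chain_partition {P : Type*} [PartialOrder P] {d : ℕ}
    {S : Finset P} (hS : IsAntichain (· ≤ ·) (↑S : Set P)) (hcard : S.card = d)
    {Q : Fin d → Set P} (hchain : ∀ i, IsChain (· ≤ ·) (Q i)) (hpart : ∀ p : P, ∃! i, p ∈ Q i)
    (i : Fin d) : ∃! a, a ∈ (↑S : Set P) ∩ Q i := by
  have huniq : ∀ j, ∀ a ∈ S, ∀ b ∈ S, a ∈ Q j → b ∈ Q j → a = b := fun j a ha b hb haj hbj =>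
    ((hchain j).total haj hbj).elim (hS.eq ha hb) fun h => (hS.eq hb ha h).symm
  choose f hf _ using hpart
  have hinj : Set.InjOn f S := fun a ha b hb hab =>
    huniq (f a) a ha b hb (hf a) (hab ▸ hf b)
  have himage : S.image f = Finset.univ := by
    rw [← Finset.card_eq_iff_eq_univ, Finset.card_image_of_injOn hinj, hcard, Fintype.card_fin]
  obtain ⟨a, ha, rfl⟩ := Finset.mem_image.1 (himage ▸ Finset.mem_univ i)
  exact ⟨a, ⟨ha, hf a⟩, fun b hb => huniq (f a) b hb.1 a ha hb.2 (hf a)⟩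

/-- If every element of a poset lies below an element of an antichain `S`, then an element of `S`
is the maximum of every chain containing it. -/
theorem IsAntichain.le_of_mem_chain {P : Type*} [PartialOrder P] {S Q : Set P}
    (hS : IsAntichain (· ≤ ·) S) (hbelow : ∀ p : P, ∃ x ∈ S, p ≤ x)
    (hQ : IsChain (· ≤ ·) Q) {a q : P} (haS : a ∈ S) (haQ : a ∈ Q) (hq : q ∈ Q) : q ≤ a := by
  refine (hQ.total hq haQ).elim id fun haq => ?_
  obtain ⟨x, hx, hqx⟩ := hbelow q
  exact hS.eq haS hx (haq.trans hqx) ▸ hqx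

/-- If every element of a poset lies above an element of an antichain `S`, then an element of `S`
is the minimum of every chain containing it. -/
theorem IsAntichain.ge_of_mem_chain {P : Type*} [PartialOrder P] {S Q : Set P}
    (hS : IsAntichain (· ≤ ·) S) (habove : ∀ p : P, ∃ y ∈ S, y ≤ p)
    (hQ : IsChain (· ≤ ·) Q) {b q : P} (hbS : b ∈ S) (hbQ : b ∈ Q) (hq : q ∈ Q) : b ≤ q := by
  refine (hQ.total hbQ hq).elim id fun hqb => ?_
  obtain ⟨y, hy, hyq⟩ := habove q
  exact (hS.eq hy hbS (hyq.trans hqb)) ▸ hyq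

/-- Let `P` be a poset and `A`, `B` antichains of the same finite cardinality
`d` such that every `p ∈ P` satisfies `x ≥ p ≥ y` for some `x ∈ A`, `y ∈ B`.
If `P` is partitioned into `d` chains, then each chain contains exactly one
element of `A` and exactly one element of `B`, and these are respectively the
maximum and the minimum of that chain. -/
theorem chain_partition_max_min {P : Type*} [PartialOrder P] (d : ℕ)
    (A B : Finset P)
    (hA : IsAntichain (· ≤ ·) (↑A : Set P)) (hB : IsAntichain (· ≤ ·) (↑B : Set P))
    (hAcard : A.card = d) (hBcard : B.card = d)
    (hbetween : ∀ p : P, ∃ x ∈ A, ∃ y ∈ B, y ≤ p ∧ p ≤ x)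
    (Q : Fin d → Set P)
    (hchain : ∀ i, IsChain (· ≤ ·) (Q i))
    (hpart : ∀ p : P, ∃! i, p ∈ Q i) :
    ∀ i,
      (∃! a, a ∈ (↑A : Set P) ∩ Q i) ∧
      (∃! b, b ∈ (↑B : Set P) ∩ Q i) ∧
      (∀ a ∈ (↑A : Set P) ∩ Q i, ∀ q ∈ Q i, q ≤ a) ∧
      (∀ b ∈ (↑B : Set P) ∩ Q i, ∀ q ∈ Q i, b ≤ q) := by
  have hbelow : ∀ p : P, ∃ x ∈ (↑A : Set P), p ≤ x := fun p =>
    let ⟨x, hx, _, _, _, hpx⟩ := hbetween p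
    ⟨x, hx, hpx⟩
  have habove : ∀ p : P, ∃ y ∈ (↑B : Set P), y ≤ p := fun p =>
    let ⟨_, _, y, hy, hyp, _⟩ := hbetween p
    ⟨y, hy, hyp⟩
  exact fun i => ⟨hA.existsUnique_mem_inter_of_chain_partition hAcard hchain hpart i,
    hB.existsUnique_mem_inter_of_chain_partition hBcard hchain hpart i,
    fun _ ha _ hq => hA.le_of_mem_chain hbelow (hchain i) ha.1 ha.2 hq,
    fun _ hb _ hq => hB.ge_of_mem_chain habove (hchain i) hb.1 hb.2 hq⟩
end
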